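/- arXiv:1207.5302 — 3 statements merged into one kernel-verified Lean document; each statement's English description precedes it below -/
import Mathlib

section
/- For every real g and every x > 0, W[φ̃₂^III(·;g), φ̃₁^II(·;g)](x) = (1/8) x^{3−2g} (−135 + 174g − 68g² + 8g³ + (−54 + 48g − 8g²)x² + (36 − 8g)x⁴ + 8x⁶), and at g = 9/4 this equals (3 + 4x²)³ / (64 x^{3/2}). -/
/-- The degree-`v` generalized Laguerre polynomial `L_v^{(α)}(y)` for `v ∈ {1,2,3}`. -/
noncomputable def Lv (v : ℕ) (α y : ℝ) : ℝ :=
  if v = 1 then α + 1 - y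
  else if v = 2 then ((α+1)*(α+2) - 2*(α+2)*y + y^2)/2
  else ((α+1)*(α+2)*(α+3) - 3*(α+2)*(α+3)*y + 3*(α+3)*y^2 - y^3)/6

/-- Type I seed function `φ̃_v^I(x;g) = e^{x²/2} x^g L_v^{(g-1/2)}(-x²)`. -/
noncomputable def seedI (v : ℕ) (g x : ℝ) : ℝ :=
  Real.exp (x^2/2) * x ^ g * Lv v (g - 1/2) (-x^2)

/-- Type II seed function `φ̃_v^II(x;g) = e^{-x²/2} x^{1-g} L_v^{(1/2-g)}(x²)`. -/
noncomputable def seedII (v : ℕ) (g x : ℝ) : ℝ :=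
  Real.exp (-x^2/2) * x ^ (1-g) * Lv v (1/2 - g) (x^2)

/-- Type III seed function `φ̃_v^III(x;g) = e^{x²/2} x^{1-g} L_v^{(1/2-g)}(-x²)`. -/
noncomputable def seedIII (v : ℕ) (g x : ℝ) : ℝ :=
  Real.exp (x^2/2) * x ^ (1-g) * Lv v (1/2 - g) (-x^2)

/-- The Wronskian `W[f,g](x) = f(x)g'(x) - f'(x)g(x)`. -/
noncomputable def Wr (f g : ℝ → ℝ) (x : ℝ) : ℝ :=
  f x * deriv g x - deriv f x * g x

theorem hasDerivAt_exp_mul_rpow_mul {h p : ℝ → ℝ} {h' p' s x : ℝ} (hx : 0 < x)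
    (hh : HasDerivAt h h' x) (hp : HasDerivAt p p' x) :
    HasDerivAt (fun y => Real.exp (h y) * y ^ s * p y)
      (Real.exp (h x) * x ^ s * ((h' + s / x) * p x + p')) x := by
  refine ((hh.exp.mul (Real.hasDerivAt_rpow_const (p := s) (Or.inl hx.ne'))).mul hp).congr_deriv ?_
  rw [Real.rpow_sub_one hx.ne', Pi.mul_apply]
  ring

/-- The two seeds share the power factor, and their exponential factors cancel. -/
theorem Wr_exp_mul_rpow_mul {h p q : ℝ → ℝ} {h' p' q' s x : ℝ} (hx : 0 < x)
    (hh : HasDerivAt h h' x) (hp : HasDerivAt p p' x) (hq : HasDerivAt q q' x) :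
    Wr (fun y => Real.exp (h y) * y ^ s * p y) (fun y => Real.exp (-h y) * y ^ s * q y) x
      = x ^ (2 * s) * (p x * q' - p' * q x - 2 * h' * p x * q x) := by
  unfold Wr
  rw [(hasDerivAt_exp_mul_rpow_mul hx hh hp).deriv,
    (hasDerivAt_exp_mul_rpow_mul hx hh.fun_neg hq).deriv, two_mul s, Real.rpow_add hx]
  have he : Real.exp (h x) * Real.exp (-h x) = 1 := by rw [← Real.exp_add]; simp
  linear_combination (x ^ s * x ^ s * (p x * q' - p' * q x - 2 * h' * p x * q x)) * he

theorem hasDerivAt_Lv_one_sq (α x : ℝ) :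
    HasDerivAt (fun y => Lv 1 α (y ^ 2)) (-(2 * x)) x := by
  simpa [Lv] using (hasDerivAt_pow 2 x).const_sub (α + 1)

theorem hasDerivAt_Lv_two_neg_sq (α x : ℝ) :
    HasDerivAt (fun y => Lv 2 α (-y ^ 2)) (2 * x * (α + 2 + x ^ 2)) x := by
  have hy := (hasDerivAt_pow 2 x).fun_neg
  simp only [Lv, OfNat.ofNat_ne_one, if_false, if_true]
  refine ((((hy.const_mul (2 * (α + 2))).const_sub ((α + 1) * (α + 2))).fun_add
    (hy.fun_pow 2)).div_const 2).congr_deriv ?_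
  push_cast
  ring

theorem Wr_seedIII_two_seedII_one {x : ℝ} (hx : 0 < x) (g : ℝ) :
    Wr (seedIII 2 g) (seedII 1 g) x
      = (1/8) * x ^ (3 - 2*g)
          * (-135 + 174*g - 68*g^2 + 8*g^3 + (-54 + 48*g - 8*g^2)*x^2
            + (36 - 8*g)*x^4 + 8*x^6) := by
  have hh : HasDerivAt (fun y : ℝ => y ^ 2 / 2) x x := by
    simpa using (hasDerivAt_pow 2 x).div_const 2
  have hII : seedII 1 g = fun y =>
      Real.exp (-(y ^ 2 / 2)) * y ^ (1 - g) * Lv 1 (1/2 - g) (y ^ 2) := by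
    ext y
    rw [seedII, neg_div]
  have hpow : x ^ (3 - 2 * g) = x ^ (2 * (1 - g)) * x := by
    rw [← Real.rpow_add_one hx.ne']
    ring_nf
  rw [hII, hpow]
  refine (Wr_exp_mul_rpow_mul hx hh (hasDerivAt_Lv_two_neg_sq _ x)
    (hasDerivAt_Lv_one_sq _ x)).trans ?_
  simp only [Lv]
  norm_num
  ring

/-- explicit form of `W[φ̃₂^III(·;g), φ̃₁^II(·;g)]`, and its value at `g = 9/4`. -/
theorem wronskian_C_generic (x : ℝ) (hx : 0 < x) :
    (∀ g : ℝ,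
      Wr (seedIII 2 g) (seedII 1 g) x
        = (1/8) * x ^ (3 - 2*g)
            * (-135 + 174*g - 68*g^2 + 8*g^3 + (-54 + 48*g - 8*g^2)*x^2 + (36 - 8*g)*x^4 + 8*x^6)) ∧
    Wr (seedIII 2 (9/4)) (seedII 1 (9/4)) x = (3 + 4*x^2)^3 / (64 * x ^ ((3:ℝ)/2)) := by
  refine ⟨Wr_seedIII_two_seedII_one hx, ?_⟩
  have hpow : x ^ (3 - 2 * (9 / 4) : ℝ) = (x ^ ((3 : ℝ) / 2))⁻¹ := by
    rw [← Real.rpow_neg hx.le]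
    norm_num
  rw [Wr_seedIII_two_seedII_one hx, hpow]
  have := (Real.rpow_pos_of_pos hx ((3 : ℝ) / 2)).ne'
  field_simp
  ring
end

section
/- For every x > 0, W[φ̃₁^III(·;9/4), φ̃₂^II(·;9/4)](x) = −(−3 + 4x²)³ / (64 x^{3/2}). -/
/-- Logarithmic form of the derivative of `e^{c t²/2} t^a P(t)` at a positive point. -/
theorem hasDerivAt_exp_mul_rpow_mul_s7 {P : ℝ → ℝ} {P' x : ℝ} (c a : ℝ) (hx : 0 < x)
    (hP : HasDerivAt P P' x) :
    HasDerivAt (fun t => Real.exp (c * t^2/2) * t ^ a * P t)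
      (Real.exp (c * x^2/2) * x ^ a * (P' + (c * x + a / x) * P x)) x := by
  have hE : HasDerivAt (fun t : ℝ => Real.exp (c * t^2/2)) (Real.exp (c * x^2/2) * (c * x)) x := by
    convert (((hasDerivAt_pow 2 x).const_mul c).div_const 2).exp using 1
    push_cast
    ring
  have hR : HasDerivAt (fun t : ℝ => t ^ a) (a * x ^ (a - 1)) x :=
    Real.hasDerivAt_rpow_const (Or.inl hx.ne')
  refine ((hE.mul hR).mul hP).congr_deriv ?_
  rw [Real.rpow_sub_one hx.ne']
  simp only [Pi.mul_apply]
  ring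

/-- The Wronskian of two functions `e^{± t²/2} t^a P(t)` with opposite exponential factors. -/
theorem Wr_exp_mul_rpow_mul_s7 {P Q : ℝ → ℝ} {P' Q' x : ℝ} (a : ℝ) (hx : 0 < x)
    (hP : HasDerivAt P P' x) (hQ : HasDerivAt Q Q' x) :
    Wr (fun t => Real.exp (t^2/2) * t ^ a * P t) (fun t => Real.exp (-t^2/2) * t ^ a * Q t) x =
      x ^ (2 * a) * (P x * Q' - P' * Q x - 2 * x * P x * Q x) := by
  have hf := hasDerivAt_exp_mul_rpow_mul_s7 1 a hx hP
  have hg := hasDerivAt_exp_mul_rpow_mul_s7 (-1) a hx hQ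
  simp only [one_mul, neg_one_mul] at hf hg
  have hexp : Real.exp (x^2/2) * Real.exp (-x^2/2) = 1 := by
    rw [← Real.exp_add, neg_div, add_neg_cancel, Real.exp_zero]
  have hpow : x ^ (2 * a) = x ^ a * x ^ a := by rw [← Real.rpow_add hx, two_mul]
  rw [Wr, hf.deriv, hg.deriv, hpow]
  linear_combination (x ^ a * x ^ a * (P x * Q' - P' * Q x - 2 * x * P x * Q x)) * hexp

/-- at `g = 9/4`, `W[φ̃₁^III, φ̃₂^II](x) = −(−3+4x²)³/(64 x^{3/2})`. -/
theorem wronskian_D_cubic_zero (x : ℝ) (hx : 0 < x) :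
    Wr (seedIII 1 (9/4)) (seedII 2 (9/4)) x = -((-3 + 4*x^2)^3 / (64 * x ^ ((3:ℝ)/2))) := by
  have hexponent : (1 - 9/4 : ℝ) = -5/4 := by norm_num
  have hf : seedIII 1 (9/4) = fun t : ℝ =>
      Real.exp (t^2/2) * t ^ (-5/4 : ℝ) * (t^2 - 3/4) := by
    funext t
    simp only [seedIII, Lv, hexponent, reduceIte]
    ring
  have hg : seedII 2 (9/4) = fun t : ℝ =>
      Real.exp (-t^2/2) * t ^ (-5/4 : ℝ) * ((t^2 - 3/4) * (t^2 + 1/4) / 2) := by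
    funext t
    simp only [seedII, Lv, hexponent, reduceIte, OfNat.ofNat_ne_one]
    ring
  have hP : HasDerivAt (fun t : ℝ => t^2 - 3/4) (2 * x) x := by
    simpa using (hasDerivAt_pow 2 x).sub_const (3/4)
  have hS : HasDerivAt (fun t : ℝ => t^2 + 1/4) (2 * x) x := by
    simpa using (hasDerivAt_pow 2 x).add_const (1/4)
  have hpow : x ^ (2 * (-5/4) : ℝ) * x * x ^ ((3:ℝ)/2) = 1 := by
    rw [← Real.rpow_add_one hx.ne', ← Real.rpow_add hx]
    norm_num
  have hQ : HasDerivAt (fun t : ℝ => (t^2 - 3/4) * (t^2 + 1/4) / 2)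
      ((2 * x * (x^2 + 1/4) + (x^2 - 3/4) * (2 * x)) / 2) x :=
    (hP.mul hS).div_const 2
  rw [hf, hg, Wr_exp_mul_rpow_mul_s7 (-5/4) hx hP hQ, ← neg_div,
    eq_div_iff (by positivity)]
  linear_combination (-(-3 + 4*x^2)^3) * hpow
end

section
/- For every natural number n ≥ 0, the polynomial 𝓛ᴱ_n(η) := (−24(840 + 280η + 30η² + η³) − 4n(6+η)²(14+η)) L_n^{(7)}(η) − 16η(6+η)(12+η) (d/dη)L_n^{(7)}(η) has degree n+3 and satisfies, for all real η, the differential equation η(6+η)(14+η) 𝓛ᴱ_n''(η) − (−672 − 8η + 18η² + η³) 𝓛ᴱ_n'(η) + (−224 + 18η + 3η² + n(6+η)(14+η)) 𝓛ᴱ_n(η) = 0. -/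
/-- The generalized Laguerre polynomial
`L_n^{(α)}(y) = Σ_{k=0}^{n} ((−1)^k/(k!(n−k)!)) (Π_{j=k+1}^{n} (α+j)) y^k`. -/
noncomputable def genLag (n : ℕ) (α : ℝ) (y : ℝ) : ℝ :=
  ∑ k ∈ Finset.range (n+1),
    ((-1:ℝ)^k / ((Nat.factorial k : ℝ) * (Nat.factorial (n-k) : ℝ)))
      * (∏ j ∈ Finset.Icc (k+1) n, (α + (j:ℝ))) * y^k

/-- The polynomial `𝓛ᴱ_n(η)` of case (E). -/
noncomputable def LagE (n : ℕ) (η : ℝ) : ℝ :=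
  (-24*(840 + 280*η + 30*η^2 + η^3) - 4*(n:ℝ)*(6+η)^2*(14+η)) * genLag n 7 η
    - 16*η*(6+η)*(12+η) * deriv (genLag n 7) η

open Polynomial in
/-- The generalized Laguerre polynomial `genLag n α` as an element of `ℝ[X]`. -/
noncomputable def genLagPoly (n : ℕ) (α : ℝ) : ℝ[X] :=
  ∑ k ∈ Finset.range (n+1),
    C (((-1:ℝ)^k / ((Nat.factorial k : ℝ) * (Nat.factorial (n-k) : ℝ)))
      * (∏ j ∈ Finset.Icc (k+1) n, (α + (j:ℝ)))) * X^k

theorem genLag_eq_eval (n : ℕ) (α : ℝ) :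
    genLag n α = fun y => (genLagPoly n α).eval y := by
  ext y
  simp only [genLag, genLagPoly, Polynomial.eval_finsetSum, Polynomial.eval_mul, Polynomial.eval_C,
    Polynomial.eval_pow, Polynomial.eval_X]

theorem coeff_genLagPoly (n : ℕ) (α : ℝ) (k : ℕ) :
    (genLagPoly n α).coeff k = if k < n + 1 then
      ((-1:ℝ)^k / ((Nat.factorial k : ℝ) * (Nat.factorial (n-k) : ℝ)))
        * (∏ j ∈ Finset.Icc (k+1) n, (α + (j:ℝ))) else 0 := by
  simp only [genLagPoly, Polynomial.finsetSum_coeff, Polynomial.coeff_C_mul_X_pow,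
    Finset.sum_ite_eq, Finset.mem_range]

theorem coeff_genLagPoly_succ (n : ℕ) (α : ℝ) (k : ℕ) :
    ((k:ℝ) + 1) * (k + 1 + α) * (genLagPoly n α).coeff (k + 1)
      + ((n:ℝ) - k) * (genLagPoly n α).coeff k = 0 := by
  rw [coeff_genLagPoly, coeff_genLagPoly]
  rcases lt_trichotomy k n with h | rfl | h
  · obtain ⟨m, rfl⟩ := Nat.exists_eq_add_of_lt h
    rw [if_pos (by omega), if_pos (by omega),
      ← Finset.mul_prod_Ioc_eq_prod_Icc (f := fun j : ℕ => α + (j:ℝ))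
        (show k + 1 ≤ k + m + 1 by omega),
      ← Finset.Icc_add_one_left_eq_Ioc, show k + m + 1 - k = m + 1 by omega,
      show k + m + 1 - (k + 1) = m by omega, Nat.factorial_succ, Nat.factorial_succ]
    push_cast
    have hk : (k.factorial : ℝ) ≠ 0 := by positivity
    have hm : (m.factorial : ℝ) ≠ 0 := by positivity
    have hk' : (k : ℝ) + 1 ≠ 0 := by positivity
    have hm' : (m : ℝ) + 1 ≠ 0 := by positivity
    field_simp
    ring
  · simp
  · rw [if_neg (by omega), if_neg (by omega)]
    simp

open Polynomial in
theorem genLagPoly_ode (n : ℕ) (α : ℝ) :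
    X * derivative (derivative (genLagPoly n α)) + (C (α + 1) - X) * derivative (genLagPoly n α)
      + C (n:ℝ) * genLagPoly n α = 0 := by
  ext k
  have h := coeff_genLagPoly_succ n α k
  rcases k with _ | k
  · simp only [coeff_add, sub_mul, coeff_sub, coeff_C_mul, coeff_X_mul_zero, coeff_derivative,
      coeff_zero]
    push_cast at h ⊢
    linear_combination h
  · simp only [coeff_add, sub_mul, coeff_sub, coeff_C_mul, coeff_X_mul, coeff_derivative,
      coeff_zero]
    push_cast at h ⊢
    linear_combination h

theorem natDegree_genLagPoly_le (n : ℕ) (α : ℝ) : (genLagPoly n α).natDegree ≤ n := by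
  rw [Polynomial.natDegree_le_iff_coeff_eq_zero]
  intro k hk
  rw [coeff_genLagPoly, if_neg (by omega)]

theorem coeff_genLagPoly_self_ne_zero (n : ℕ) (α : ℝ) : (genLagPoly n α).coeff n ≠ 0 := by
  rw [coeff_genLagPoly, if_pos (Nat.lt_succ_self n)]
  simp [Nat.factorial_ne_zero]

open Polynomial in
/-- `LagE n` as an element of `ℝ[X]`. -/
noncomputable def lagEPoly (n : ℕ) : ℝ[X] :=
  (-24*(840 + 280*X + 30*X^2 + X^3) - 4*C (n:ℝ)*(6+X)^2*(14+X)) * genLagPoly n 7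
    - 16*X*(6+X)*(12+X) * derivative (genLagPoly n 7)

theorem LagE_eq_eval (n : ℕ) : LagE n = fun η => (lagEPoly n).eval η := by
  ext η
  simp [LagE, lagEPoly, genLag_eq_eval]

open Polynomial in
theorem natDegree_lagEPoly (n : ℕ) : (lagEPoly n).natDegree = n + 3 := by
  set P := genLagPoly n 7 with hP
  have hd : P.natDegree ≤ n := natDegree_genLagPoly_le n 7
  have hA : (-24*(840 + 280*X + 30*X^2 + X^3) - 4*C (n:ℝ)*(6+X)^2*(14+X) : ℝ[X]).natDegree
      ≤ 3 := by
    compute_degree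
  have hAc : (-24*(840 + 280*X + 30*X^2 + X^3) - 4*C (n:ℝ)*(6+X)^2*(14+X) : ℝ[X]).coeff 3
      = -24 - 4 * n := by
    have : (-24*(840 + 280*X + 30*X^2 + X^3) - 4*C (n:ℝ)*(6+X)^2*(14+X) : ℝ[X])
        = C (-24 - 4*(n:ℝ)) * X^3 + C (-720 - 104*(n:ℝ)) * X^2 + C (-6720 - 816*(n:ℝ)) * X
          + C (-20160 - 2016*(n:ℝ)) := by
      simp only [map_sub, map_mul, map_neg, map_ofNat]
      ring
    rw [this]
    simp only [coeff_add, coeff_C_mul, coeff_X_pow, coeff_X, coeff_C]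
    norm_num
  have hB : (16*X*(6+X)*(12+X) * derivative P).natDegree < n + 3 := by
    rcases Nat.eq_zero_or_pos n with h0 | hn
    · have : derivative P = 0 := derivative_of_natDegree_zero (by omega)
      simp [this]
    · have h1 : (16*X*(6+X)*(12+X) : ℝ[X]).natDegree ≤ 3 := by compute_degree
      have h2 := natDegree_derivative_le P
      have h3 := natDegree_mul_le (p := (16*X*(6+X)*(12+X) : ℝ[X])) (q := derivative P)
      omega
  apply natDegree_eq_of_le_of_coeff_ne_zero
  · refine (natDegree_sub_le _ _).trans (max_le ?_ hB.le)
    exact natDegree_mul_le.trans (by rw [← hP]; omega)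
  · rw [lagEPoly, coeff_sub, ← hP, coeff_eq_zero_of_natDegree_lt hB, sub_zero, add_comm n 3,
      coeff_mul_add_eq_of_natDegree_le hA hd, hAc]
    have hn : (-24 - 4 * (n:ℝ)) ≠ 0 := by
      have : (0:ℝ) ≤ n := n.cast_nonneg
      linarith
    exact mul_ne_zero hn (coeff_genLagPoly_self_ne_zero n 7)

open Polynomial in
theorem lagEPoly_ode (n : ℕ) :
    X*(6+X)*(14+X) * derivative (derivative (lagEPoly n))
      - (-672 - 8*X + 18*X^2 + X^3) * derivative (lagEPoly n)
      + (-224 + 18*X + 3*X^2 + C (n:ℝ)*(6+X)*(14+X)) * lagEPoly n = 0 := by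
  have h0 := genLagPoly_ode n 7
  have h1 := congrArg derivative h0
  have hα : (C (7 + 1 : ℝ) : ℝ[X]) = 8 := by
    rw [← map_ofNat C 8]; norm_num
  rw [hα] at h0 h1
  simp only [lagEPoly, pow_succ, pow_zero, one_mul]
  simp only [derivative_add, derivative_sub, derivative_mul, derivative_neg, derivative_X,
    derivative_ofNat, derivative_C, derivative_zero, derivative_one] at h1 ⊢
  generalize genLagPoly n 7 = P at *
  generalize derivative (derivative (derivative P)) = P3 at *
  generalize derivative (derivative P) = P2 at *
  generalize derivative P = P1 at *
  generalize C (n:ℝ) = N at *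
  linear_combination (-16*X*(6+X)^2*(12+X)*(14+X)) * h1
    + ((6+X)*(14+X)*(-24*(840 + 280*X + 30*X^2 + X^3) - 4*N*(6+X)^2*(14+X)
        - 32*(72 + 36*X + 3*X^2)) + 16*(-672 - 8*X + 18*X^2 + X^3)*(6+X)*(12+X)
      + 16*(6+X)^2*(12+X)*(14+X)*(9-X)) * h0

/-- `𝓛ᴱ_n` has degree `n+3` and satisfies the second-order differential
equation of case (E). -/
theorem LE_degree_and_ode (n : ℕ) :
    (∃ p : Polynomial ℝ, p.natDegree = n + 3 ∧ ∀ η : ℝ, p.eval η = LagE n η) ∧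
    (∀ η : ℝ,
      η*(6+η)*(14+η) * deriv (deriv (LagE n)) η - (-672 - 8*η + 18*η^2 + η^3) * deriv (LagE n) η
        + (-224 + 18*η + 3*η^2 + (n:ℝ)*(6+η)*(14+η)) * LagE n η = 0) := by
  refine ⟨⟨lagEPoly n, natDegree_lagEPoly n, fun η => by rw [LagE_eq_eval]⟩, fun η => ?_⟩
  have hd (p : Polynomial ℝ) : deriv (fun x => p.eval x) = fun x => p.derivative.eval x :=
    funext fun x => p.deriv
  have h := congrArg (Polynomial.eval η) (lagEPoly_ode n)
  rw [LagE_eq_eval, hd, hd]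
  simpa using h
end
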